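/- arXiv:2309.11726 — 5 statements merged into one kernel-verified Lean document; each statement's English description precedes it below -/
import Mathlib

section
/- Let c be a positive integer, let D : Fin c → ℝ with D i > 0 for all i and ∑ i, D i = 1 (the stratum frequencies), let ζ : Fin c → ℝ with ζ i ≥ 0 for all i (the per-stratum complexities), let δ : Fin c → ℝ with 0 < δ i < 1 for all i (the per-stratum failure probabilities), and let n > 0 be a real sample budget. Define p i = D i * Real.sqrt (ζ i + Real.log (1 / δ i)) and the allocation n* i = n * (p i)^(2/3) / ∑ j, (p j)^(2/3). Then ∑ i, n* i = n, and for every m : Fin c → ℝ with m i > 0 for all i and ∑ i, m i ≤ n, one has ∑ i, D i * Real.sqrt ((ζ i + Real.log (1 / δ i)) / n* i) ≤ ∑ i, D i * Real.sqrt ((ζ i + Real.log (1 / δ i)) / m i). -/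
/-- The tangent-line inequality for the convex function `u ↦ 1 / √u` at `v`. -/
lemma inv_sqrt_tangent_le {u v : ℝ} (hu : 0 < u) (hv : 0 < v) :
    1 / √v - (u - v) / (2 * (v * √v)) ≤ 1 / √u := by
  obtain ⟨x, hx, rfl⟩ : ∃ x : ℝ, 0 < x ∧ x ^ 2 = u :=
    ⟨√u, Real.sqrt_pos.2 hu, Real.sq_sqrt hu.le⟩
  obtain ⟨y, hy, rfl⟩ : ∃ y : ℝ, 0 < y ∧ y ^ 2 = v :=
    ⟨√v, Real.sqrt_pos.2 hv, Real.sq_sqrt hv.le⟩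
  rw [Real.sqrt_sq hx.le, Real.sqrt_sq hy.le, ← sub_nonneg]
  have h : 1 / x - (1 / y - (x ^ 2 - y ^ 2) / (2 * (y ^ 2 * y))) =
      (x - y) ^ 2 * (x + 2 * y) / (2 * x * y ^ 3) := by
    field_simp
    ring
  rw [h]
  positivity

/-- If `v = r * p ^ (2 / 3)`, then `v ^ (3 / 2)` is proportional to `p`. -/
lemma mul_rpow_two_thirds_mul_sqrt {r p : ℝ} (hr : 0 ≤ r) (hp : 0 ≤ p) :
    r * p ^ ((2 : ℝ) / 3) * √(r * p ^ ((2 : ℝ) / 3)) = r * √r * p := by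
  rw [Real.sqrt_mul hr, Real.sqrt_eq_rpow (p ^ ((2 : ℝ) / 3)), ← Real.rpow_mul hp]
  have h : p ^ ((2 : ℝ) / 3) * p ^ ((2 : ℝ) / 3 * (1 / 2)) = p := by
    rw [← Real.rpow_add_of_nonneg hp (by norm_num) (by norm_num)]
    norm_num
  linear_combination r * √r * h

/-- The sum `∑ i, p i / √(m i)` over positive `m` of total at most `n` is minimized by
`m i` proportional to `p i ^ (2 / 3)`. -/
lemma sum_div_sqrt_le_of_proportional {ι : Type*} [Fintype ι] {p v m : ι → ℝ} {r : ℝ}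
    (hr : 0 < r) (hp : ∀ i, 0 < p i) (hv : ∀ i, v i = r * p i ^ ((2 : ℝ) / 3))
    (hm : ∀ i, 0 < m i) (hmv : ∑ i, m i ≤ ∑ i, v i) :
    ∑ i, p i / √(v i) ≤ ∑ i, p i / √(m i) := by
  have hterm (i : ι) :
      p i / √(v i) - (m i - v i) / (2 * (r * √r)) ≤ p i / √(m i) := by
    have hvi : 0 < v i := by
      rw [hv]
      exact mul_pos hr (Real.rpow_pos_of_pos (hp i) _)
    have h := mul_le_mul_of_nonneg_left (inv_sqrt_tangent_le (hm i) hvi) (hp i).le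
    have hprop : v i * √(v i) = r * √r * p i := by
      rw [hv, mul_rpow_two_thirds_mul_sqrt hr.le (hp i).le]
    rw [hprop] at h
    have hpi := hp i
    have hsr : 0 < √r := Real.sqrt_pos.2 hr
    calc
      _ = p i * (1 / √(v i) - (m i - v i) / (2 * (r * √r * p i))) := by
        field_simp
      _ ≤ p i * (1 / √(m i)) := h
      _ = p i / √(m i) := mul_one_div _ _
  have hsum := Finset.sum_le_sum fun i (_ : i ∈ Finset.univ) => hterm i
  rw [Finset.sum_sub_distrib, ← Finset.sum_div, Finset.sum_sub_distrib] at hsum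
  have hnonpos : (∑ i, m i - ∑ i, v i) / (2 * (r * √r)) ≤ 0 :=
    div_nonpos_of_nonpos_of_nonneg (sub_nonpos.2 hmv) (by positivity)
  linarith

/-- Optimal sample allocation for training stratified surrogates:
the allocation `n* i = n * (p i)^(2/3) / ∑ j, (p j)^(2/3)` with
`p i = D i * sqrt (ζ i + log (1/δ i))` exhausts the budget and minimizes
the error bound `∑ i, D i * sqrt ((ζ i + log (1/δ i)) / m i)`. -/
theorem optimal_stratified_sampling
    (c : ℕ) (hc : 0 < c) (D ζ δ : Fin c → ℝ)
    (hD : ∀ i, 0 < D i) (hDsum : ∑ i, D i = 1)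
    (hζ : ∀ i, 0 ≤ ζ i) (hδ : ∀ i, 0 < δ i ∧ δ i < 1)
    (n : ℝ) (hn : 0 < n)
    (p : Fin c → ℝ) (hp : ∀ i, p i = D i * Real.sqrt (ζ i + Real.log (1 / δ i)))
    (nstar : Fin c → ℝ)
    (hnstar : ∀ i, nstar i = n * p i ^ ((2 : ℝ) / 3) / ∑ j, p j ^ ((2 : ℝ) / 3)) :
    (∑ i, nstar i = n) ∧
    ∀ m : Fin c → ℝ, (∀ i, 0 < m i) → (∑ i, m i ≤ n) →
      ∑ i, D i * Real.sqrt ((ζ i + Real.log (1 / δ i)) / nstar i) ≤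
      ∑ i, D i * Real.sqrt ((ζ i + Real.log (1 / δ i)) / m i) := by
  have hA (i : Fin c) : 0 < ζ i + Real.log (1 / δ i) :=
    add_pos_of_nonneg_of_pos (hζ i) (Real.log_pos (one_lt_one_div (hδ i).1 (hδ i).2))
  have hp_pos (i : Fin c) : 0 < p i := by
    rw [hp]
    exact mul_pos (hD i) (Real.sqrt_pos.2 (hA i))
  have : Nonempty (Fin c) := ⟨⟨0, hc⟩⟩
  have hS : 0 < ∑ j, p j ^ ((2 : ℝ) / 3) :=
    Finset.sum_pos (fun j _ => Real.rpow_pos_of_pos (hp_pos j) _) Finset.univ_nonempty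
  have hsum : ∑ i, nstar i = n := by
    simp_rw [hnstar]
    rw [← Finset.sum_div, ← Finset.mul_sum, mul_div_cancel_right₀ _ hS.ne']
  refine ⟨hsum, fun m hm hmn => ?_⟩
  have hterm (u : Fin c → ℝ) (i : Fin c) :
      D i * √((ζ i + Real.log (1 / δ i)) / u i) = p i / √(u i) := by
    rw [Real.sqrt_div (hA i).le, hp, mul_div_assoc]
  simp_rw [hterm]
  exact sum_div_sqrt_le_of_proportional (div_pos hn hS) hp_pos
    (fun i => by rw [hnstar, mul_div_right_comm]) hm (hmn.trans_eq hsum.symm)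
end

section
/- Let c be a positive integer, p : Fin c → ℝ with p i > 0 for all i, and n > 0 a real number. Define n* i = n * (p i)^(2/3) / ∑ j, (p j)^(2/3). Then for every m : Fin c → ℝ with m i > 0 for all i and ∑ i, m i ≤ n, one has ∑ i, p i / Real.sqrt (m i) ≥ ∑ i, p i / Real.sqrt (n* i) = (∑ j, (p j)^(2/3))^(3/2) / Real.sqrt n. In particular, the allocation n* globally minimizes the objective m ↦ ∑ i, p i / Real.sqrt (m i) over the feasible set {m | (∀ i, m i > 0) ∧ ∑ i, m i ≤ n}. -/
/-- The tangent line of `t ↦ 1 / √t` at `b` lies below its graph. -/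
lemma tangent_le_one_div_sqrt {a b : ℝ} (ha : 0 < a) (hb : 0 < b) :
    1 / √b - (a - b) / (2 * √b ^ 3) ≤ 1 / √a := by
  have hx := Real.sqrt_pos.2 ha
  have hy := Real.sqrt_pos.2 hb
  have hxa := Real.sq_sqrt ha.le
  have hyb := Real.sq_sqrt hb.le
  generalize √a = x at *
  generalize √b = y at *
  subst hxa hyb
  have key : 1 / x - (1 / y - (x ^ 2 - y ^ 2) / (2 * y ^ 3))
      = (x - y) ^ 2 * (x + 2 * y) / (2 * x * y ^ 3) := by
    field_simp
    ring
  have : 0 ≤ (x - y) ^ 2 * (x + 2 * y) / (2 * x * y ^ 3) := by positivity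
  linarith

/-- Core optimization fact: the allocation `n* i = n * (p i)^(2/3) / ∑ j, (p j)^(2/3)`
globally minimizes `m ↦ ∑ i, p i / sqrt (m i)` over `{m | (∀ i, m i > 0) ∧ ∑ i, m i ≤ n}`,
with minimal value `(∑ j, (p j)^(2/3))^(3/2) / sqrt n`. -/
theorem weighted_inverse_sqrt_minimization
    (c : ℕ) (hc : 0 < c) (p : Fin c → ℝ) (hp : ∀ i, 0 < p i)
    (n : ℝ) (hn : 0 < n)
    (nstar : Fin c → ℝ)
    (hnstar : ∀ i, nstar i = n * p i ^ ((2 : ℝ) / 3) / ∑ j, p j ^ ((2 : ℝ) / 3)) :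
    (∑ i, p i / Real.sqrt (nstar i)
        = (∑ j, p j ^ ((2 : ℝ) / 3)) ^ ((3 : ℝ) / 2) / Real.sqrt n) ∧
    ∀ m : Fin c → ℝ, (∀ i, 0 < m i) → (∑ i, m i ≤ n) →
      ∑ i, p i / Real.sqrt (nstar i) ≤ ∑ i, p i / Real.sqrt (m i) := by
  have hne : Nonempty (Fin c) := ⟨⟨0, hc⟩⟩
  obtain ⟨q, hq, rfl⟩ : ∃ q : Fin c → ℝ, (∀ i, 0 < q i) ∧ p = fun i ↦ q i ^ 3 := by
    refine ⟨fun i ↦ p i ^ ((1 : ℝ) / 3), fun i ↦ Real.rpow_pos_of_pos (hp i) _, ?_⟩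
    funext i
    rw [← Real.rpow_mul_natCast (hp i).le]
    norm_num
  have hq2 (i : Fin c) : (q i ^ 3) ^ ((2 : ℝ) / 3) = q i ^ 2 := by
    rw [← Real.rpow_natCast_mul (hq i).le, ← Real.rpow_natCast]
    norm_num
  simp only [hq2] at hnstar ⊢
  have hS : 0 < ∑ j, q j ^ 2 :=
    Finset.sum_pos (fun i _ ↦ pow_pos (hq i) 2) Finset.univ_nonempty
  have hsum : ∑ i, nstar i = n := by
    simp only [hnstar, ← Finset.sum_div, ← Finset.mul_sum]
    field_simp
  generalize hSdef : ∑ j, q j ^ 2 = S at *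
  have hpos (i : Fin c) : 0 < nstar i := by
    have := hq i
    rw [hnstar]
    positivity
  have hsqrt (i : Fin c) : √(nstar i) = √n * q i / √S := by
    rw [hnstar, Real.sqrt_div' _ hS.le, Real.sqrt_mul hn.le, Real.sqrt_sq (hq i).le]
  have hn' := Real.sqrt_pos.2 hn
  have hS' := Real.sqrt_pos.2 hS
  constructor
  · have hterm (i : Fin c) : q i ^ 3 / √(nstar i) = q i ^ 2 * (√S / √n) := by
      have := hq i
      rw [hsqrt]
      field_simp
    have hpow : S ^ ((3 : ℝ) / 2) = S * √S := by
      rw [show (3 : ℝ) / 2 = 1 + 1 / 2 by norm_num, Real.rpow_add hS, Real.rpow_one,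
        Real.sqrt_eq_rpow]
    simp only [hterm]
    rw [← Finset.sum_mul, hSdef, hpow, mul_div_assoc]
  · intro m hm hmn
    have hterm (i : Fin c) : q i ^ 3 / √(nstar i) - √S ^ 3 / (2 * √n ^ 3) * (m i - nstar i)
        ≤ q i ^ 3 / √(m i) := by
      have hqi := hq i
      have h := mul_le_mul_of_nonneg_left (tangent_le_one_div_sqrt (hm i) (hpos i))
        (pow_pos hqi 3).le
      have hslope : q i ^ 3 * ((m i - nstar i) / (2 * √(nstar i) ^ 3))
          = √S ^ 3 / (2 * √n ^ 3) * (m i - nstar i) := by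
        rw [hsqrt]
        field_simp
      rwa [mul_sub, hslope, mul_one_div, mul_one_div] at h
    have h := Finset.sum_le_sum fun i (_ : i ∈ Finset.univ) ↦ hterm i
    rw [Finset.sum_sub_distrib, ← Finset.mul_sum, Finset.sum_sub_distrib, hsum] at h
    have hslack : √S ^ 3 / (2 * √n ^ 3) * (∑ i, m i - n) ≤ 0 :=
      mul_nonpos_of_nonneg_of_nonpos (by positivity) (by linarith)
    linarith
end

section
/- Let c be a positive integer, D : Fin c → ℝ with D i > 0 for all i, and ζ : Fin c → ℝ with ζ i ≥ 0 for all i. Then for each index i, as t → ∞ the allocation fraction (D i * Real.sqrt (ζ i + t))^(2/3) / ∑ j, (D j * Real.sqrt (ζ j + t))^(2/3) tends to (D i)^(2/3) / ∑ j, (D j)^(2/3). -/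
open Filter Topology in
/-- Normalized by `(sqrt t) ^ p`, the weight `(d * sqrt (z + t)) ^ p` converges to `d ^ p`. -/
theorem tendsto_mul_sqrt_add_rpow_div {d p : ℝ} (hd : 0 < d) (z : ℝ) :
    Tendsto (fun t : ℝ => (d * Real.sqrt (z + t)) ^ p / Real.sqrt t ^ p) atTop (𝓝 (d ^ p)) := by
  have hratio : Tendsto (fun t : ℝ => z / t + 1) atTop (𝓝 1) := by
    simpa using (tendsto_const_nhds (x := z)).div_atTop tendsto_id |>.add_const 1
  have hbase : Tendsto (fun t : ℝ => d * Real.sqrt (z / t + 1)) atTop (𝓝 d) := by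
    simpa using hratio.sqrt.const_mul d
  refine (hbase.rpow_const (Or.inl hd.ne')).congr' ?_
  filter_upwards [eventually_gt_atTop 0] with t ht
  rw [← Real.div_rpow (by positivity) (by positivity), mul_div_assoc,
    ← Real.sqrt_div' _ ht.le, add_div, div_self ht.ne']

/-- Convergence note: as `t → ∞`, the allocation fraction
`(D i * sqrt (ζ i + t))^(2/3) / ∑ j, (D j * sqrt (ζ j + t))^(2/3)` tends to
`(D i)^(2/3) / ∑ j, (D j)^(2/3)`. -/
theorem allocation_fraction_tendsto
    (c : ℕ) (hc : 0 < c) (D ζ : Fin c → ℝ)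
    (hD : ∀ i, 0 < D i) (hζ : ∀ i, 0 ≤ ζ i) (i : Fin c) :
    Filter.Tendsto
      (fun t : ℝ =>
        (D i * Real.sqrt (ζ i + t)) ^ ((2 : ℝ) / 3) /
          ∑ j, (D j * Real.sqrt (ζ j + t)) ^ ((2 : ℝ) / 3))
      Filter.atTop
      (nhds ((D i) ^ ((2 : ℝ) / 3) / ∑ j, (D j) ^ ((2 : ℝ) / 3))) := by
  have hsum : ∑ j, D j ^ ((2 : ℝ) / 3) ≠ 0 :=
    (Finset.sum_pos (fun j _ => Real.rpow_pos_of_pos (hD j) _) ⟨i, Finset.mem_univ i⟩).ne'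
  refine ((tendsto_mul_sqrt_add_rpow_div (hD i) (ζ i)).div
    (tendsto_finsetSum Finset.univ fun j _ => tendsto_mul_sqrt_add_rpow_div (hD j) (ζ j))
    hsum).congr' ?_
  filter_upwards [Filter.eventually_gt_atTop 0] with t ht
  have hscale : Real.sqrt t ^ ((2 : ℝ) / 3) ≠ 0 := by positivity
  simp only [Pi.div_apply]
  rw [← Finset.sum_div, div_div_div_cancel_right₀ hscale]
end

section
/- Let 0 < δ < 1 and k > 0 be real numbers, let c be a positive integer, and let δ' : Fin c → ℝ satisfy 0 < δ' i < 1 for all i and ∏ i, (1 - δ' i) ≥ 1 - δ. Then the number of indices i with δ' i ≥ Real.exp (-k) (equivalently, with Real.log (1 / δ' i) ≤ k) is at most Real.log (1 - δ) / Real.log (1 - Real.exp (-k)). -/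
/-- A product of factors in `[0, 1]` is at most `(1 - t) ^ m`, where `m` counts the factors that
are at most `1 - t`. -/
theorem prod_one_sub_le_pow_card_filter {ι : Type*} [Fintype ι] (p : ι → ℝ) (t : ℝ)
    (hp0 : ∀ i, 0 ≤ p i) (hp1 : ∀ i, p i ≤ 1) [DecidablePred fun i => t ≤ p i] :
    ∏ i, (1 - p i) ≤ (1 - t) ^ (Finset.univ.filter fun i => t ≤ p i).card := by
  rw [← Finset.prod_const, Finset.prod_filter]
  refine Finset.prod_le_prod (fun i _ => sub_nonneg.2 (hp1 i)) fun i _ => ?_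
  split_ifs with h
  · exact sub_le_sub_left h 1
  · exact sub_le_self 1 (hp0 i)


/-- Counting bound: if per-stratum failure probabilities `δ' i` satisfy
`∏ i, (1 - δ' i) ≥ 1 - δ`, then at most `log (1 - δ) / log (1 - exp (-k))`
indices satisfy `δ' i ≥ exp (-k)` (i.e. `log (1 / δ' i) ≤ k`). -/
theorem counting_bound_failure_probabilities
    (δ k : ℝ) (hδ0 : 0 < δ) (hδ1 : δ < 1) (hk : 0 < k)
    (c : ℕ) (hc : 0 < c) (δ' : Fin c → ℝ)
    (h1 : ∀ i, 0 < δ' i ∧ δ' i < 1)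
    (h2 : 1 - δ ≤ ∏ i, (1 - δ' i)) :
    (({i : Fin c | Real.exp (-k) ≤ δ' i} : Set (Fin c)).ncard : ℝ)
      ≤ Real.log (1 - δ) / Real.log (1 - Real.exp (-k)) := by
  classical
  have hexp : Real.exp (-k) < 1 := Real.exp_lt_one_iff.2 (neg_lt_zero.2 hk)
  have hlog : Real.log (1 - Real.exp (-k)) < 0 :=
    Real.log_neg (sub_pos.2 hexp) (sub_lt_self 1 (Real.exp_pos _))
  rw [le_div_iff_of_neg hlog, Set.ncard_eq_toFinset_card', Set.toFinset_ofPred, ← Real.log_pow]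
  exact Real.log_le_log (sub_pos.2 hδ1) <| h2.trans <|
    prod_one_sub_le_pow_card_filter δ' _ (fun i => (h1 i).1.le) fun i => (h1 i).2.le
end

section
/- Let b > 0 and let x ≥ 0 satisfy x * Real.sqrt (b^2 + 1) < b. Then the series ∑ k ≥ 1, ((b^2 + 1)^(k/2) / (k * b^k)) * x^k is summable and ∑' (k : ℕ), (if k = 0 then 0 else ((Real.sqrt (b^2+1))^k / (k * b^k)) * x^k) = Real.log b - Real.log (b - x * Real.sqrt (b^2 + 1)). -/
/-- Tilde of `log` expanded around `b`: for `b > 0` and `0 ≤ x` with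
`x * sqrt (b² + 1) < b`, the series `∑_{k≥1} ((sqrt (b²+1))^k / (k b^k)) x^k`
is summable, with sum `log b - log (b - x * sqrt (b² + 1))`. -/
theorem tilde_log
    (b x : ℝ) (hb : 0 < b) (hx : 0 ≤ x)
    (hconv : x * Real.sqrt (b ^ 2 + 1) < b) :
    Summable (fun k : ℕ =>
      if k = 0 then 0 else (Real.sqrt (b ^ 2 + 1)) ^ k / ((k : ℝ) * b ^ k) * x ^ k) ∧
    ∑' k : ℕ,
        (if k = 0 then 0 else (Real.sqrt (b ^ 2 + 1)) ^ k / ((k : ℝ) * b ^ k) * x ^ k)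
      = Real.log b - Real.log (b - x * Real.sqrt (b ^ 2 + 1)) := by
  set s := Real.sqrt (b ^ 2 + 1)
  have hs : 0 ≤ s := Real.sqrt_nonneg _
  have hsum : HasSum (fun k : ℕ => if k = 0 then 0 else s ^ k / ((k : ℝ) * b ^ k) * x ^ k)
      (Real.log b - Real.log (b - x * s)) := by
    have habs : |x * s / b| < 1 := by
      rw [abs_of_nonneg (by positivity), div_lt_one hb]
      exact hconv
    have hlog : -Real.log (1 - x * s / b) = Real.log b - Real.log (b - x * s) := by
      rw [one_sub_div hb.ne', Real.log_div (sub_pos.2 hconv).ne' hb.ne', neg_sub]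
    rw [← hasSum_nat_add_iff' 1, ← hlog, Finset.sum_range_one, if_pos rfl, sub_zero]
    convert! Real.hasSum_pow_div_log_of_abs_lt_one habs using 2 with n
    rw [if_neg n.succ_ne_zero, div_pow, mul_pow]
    push_cast
    field_simp
  exact ⟨hsum.summable, hsum.tsum_eq⟩
end
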